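/- Let α ≥ 1. Then there is no constant c > 0 such that the inequality ∫_{ℝ²} (1+|x|)^{-2α} |(∂₁ - i∂₂)φ(x)|² dx ≥ c ∫_{ℝ²} (1+|x|)^{-2α} |∇φ(x)|² dx holds for all compactly supported Lipschitz functions φ : ℝ² → ℂ. Equivalently, for every c > 0 there exists a compactly supported Lipschitz function φ : ℝ² → ℂ with ∫_{ℝ²} (1+|x|)^{-2α} |∇φ|² dx > 0 and ∫_{ℝ²} (1+|x|)^{-2α} |(∂₁ - i∂₂)φ|² dx < c ∫_{ℝ²} (1+|x|)^{-2α} |∇φ|² dx. -/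

import Mathlib

open MeasureTheory Real

noncomputable section

abbrev PlaneE := EuclideanSpace ℝ (Fin 2)

/-- The conjugate coordinate `x₀ - i x₁` as a continuous linear map. -/
def conjCLM : PlaneE →L[ℝ] ℂ :=
  Complex.ofRealCLM.comp (EuclideanSpace.proj 0 : PlaneE →L[ℝ] ℝ) -
    Complex.I • Complex.ofRealCLM.comp (EuclideanSpace.proj 1 : PlaneE →L[ℝ] ℝ)

lemma conjCLM_zero : conjCLM (EuclideanSpace.single 0 1) = 1 := by
  simp [conjCLM]

lemma conjCLM_one : conjCLM (EuclideanSpace.single 1 1) = -Complex.I := by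
  simp [conjCLM]

lemma exists_psi : ∃ ψ : PlaneE → ℂ, ContDiff ℝ 1 ψ ∧ HasCompactSupport ψ ∧
    (∀ x : PlaneE, ‖x‖ < 1 → fderiv ℝ ψ x = conjCLM) ∧
    (∀ x : PlaneE, 2 < ‖x‖ → fderiv ℝ ψ x = 0) := by
  let f : ContDiffBump (0 : PlaneE) := ⟨1, 2, by norm_num, by norm_num⟩
  refine ⟨fun x => f x • conjCLM x, ?_, ?_, ?_, ?_⟩
  · exact f.contDiff.smul conjCLM.contDiff
  · exact f.hasCompactSupport.smul_right
  · intro x hx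
    have : (fun x => f x • conjCLM x) =ᶠ[nhds x] conjCLM := by
      have h : Metric.ball (0 : PlaneE) 1 ∈ nhds x :=
        Metric.isOpen_ball.mem_nhds (by simpa using hx)
      filter_upwards [h] with y hy
      rw [f.one_of_mem_closedBall (Metric.ball_subset_closedBall hy), one_smul]
    rw [this.fderiv_eq, ContinuousLinearMap.fderiv]
  · intro x hx
    have : (fun x => f x • conjCLM x) =ᶠ[nhds x] fun _ => 0 := by
      have h : {y : PlaneE | 2 < ‖y‖} ∈ nhds x :=
        (isOpen_lt continuous_const continuous_norm).mem_nhds hx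
      filter_upwards [h] with y hy
      rw [f.zero_of_le_dist (by simpa using (le_of_lt hy : (2:ℝ) ≤ ‖y‖)), zero_smul]
    rw [this.fderiv_eq]
    simp

def wt (α : ℝ) (x : PlaneE) : ℝ := (1 + ‖x‖) ^ (-(2 * α))

lemma wt_cont (α : ℝ) : Continuous (wt α) := by
  unfold wt
  refine Continuous.rpow_const (by fun_prop) ?_
  intro x
  left
  positivity

lemma wt_nonneg (α : ℝ) (x : PlaneE) : 0 ≤ wt α x := by
  unfold wt; positivity

lemma wt_integrableOn (α : ℝ) (r : ℝ) : IntegrableOn (wt α) (Metric.ball (0 : PlaneE) r) :=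
  ((wt_cont α).continuousOn.integrableOn_compact (isCompact_closedBall (0 : PlaneE) r)).mono_set
    Metric.ball_subset_closedBall

def V : ℝ := volume.real (Metric.ball (0 : PlaneE) 1)

lemma V_pos : 0 < V := by
  unfold V
  exact ENNReal.toReal_pos (Metric.measure_ball_pos _ _ one_pos).ne' measure_ball_lt_top.ne

lemma vol_ball (r : ℝ) (hr : 0 ≤ r) : volume.real (Metric.ball (0 : PlaneE) r) = r ^ 2 * V := by
  unfold V Measure.real
  rw [Measure.addHaar_ball (volume : Measure PlaneE) 0 hr, ENNReal.toReal_mul,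
    ENNReal.toReal_ofReal (by positivity)]
  simp

def sc (α : ℝ) (n : ℕ) : ℝ := ((2:ℝ) ^ n) ^ (-(2 * α)) * ((2:ℝ) ^ n) ^ 2

lemma sc_pos (α : ℝ) (n : ℕ) : 0 < sc α n := by unfold sc; positivity

lemma sc_succ (α : ℝ) (hα : 1 ≤ α) (n : ℕ) : sc α (n + 1) ≤ sc α n := by
  have h0 : (0:ℝ) < 2 ^ n := by positivity
  have h1 : (2:ℝ) ^ (-(2 * α)) ≤ 1 / 4 := by
    calc (2:ℝ) ^ (-(2 * α)) ≤ (2:ℝ) ^ (-2 : ℝ) :=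
          Real.rpow_le_rpow_of_exponent_le (by norm_num) (by linarith)
      _ = 1 / 4 := by
          rw [Real.rpow_neg (by norm_num)]; norm_num
  have h2 : sc α (n + 1) = sc α n * (4 * (2:ℝ) ^ (-(2 * α))) := by
    unfold sc
    rw [pow_succ, Real.mul_rpow h0.le (by norm_num)]
    ring
  rw [h2]
  nlinarith [sc_pos α n]

lemma lower (α : ℝ) (hα : 1 ≤ α) (n : ℕ) :
    n * ((4:ℝ) ^ (-(2 * α)) * 3 * V) * sc α n ≤ ∫ x in Metric.ball (0 : PlaneE) (2 ^ n), wt α x := by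
  induction n with
  | zero =>
    simp only [Nat.cast_zero, zero_mul]
    exact integral_nonneg (wt_nonneg α)
  | succ n ih =>
    have h0 : (1:ℝ) ≤ 2 ^ n := one_le_pow₀ (by norm_num)
    set R : ℝ := 2 ^ n with hR
    have hR2 : (2:ℝ) ^ (n + 1) = 2 * R := by rw [pow_succ]; ring
    have hsub : Metric.ball (0 : PlaneE) R ⊆ Metric.ball 0 (2 * R) :=
      Metric.ball_subset_ball (by linarith)
    have hsplit := setIntegral_sdiff (μ := volume) (f := wt α) Metric.isOpen_ball.measurableSet
      (wt_integrableOn α (2 * R)) hsub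
    have hvol : volume.real (Metric.ball (0 : PlaneE) (2 * R) \ Metric.ball 0 R) = 3 * R ^ 2 * V := by
      rw [measureReal_sdiff hsub Metric.isOpen_ball.measurableSet, vol_ball _ (by linarith),
        vol_ball _ (by linarith)]
      ring
    have hann : (4 * R) ^ (-(2 * α)) * (3 * R ^ 2 * V) ≤
        ∫ x in Metric.ball (0 : PlaneE) (2 * R) \ Metric.ball 0 R, wt α x := by
      rw [← hvol]
      refine setIntegral_ge_of_const_le_real
        (Metric.isOpen_ball.measurableSet.diff Metric.isOpen_ball.measurableSet) ?_ ?_ ?_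
      · exact ((measure_mono Set.sdiff_subset).trans_lt measure_ball_lt_top).ne
      · intro x hx
        have hx1 : ‖x‖ < 2 * R := by simpa using hx.1
        unfold wt
        exact Real.rpow_le_rpow_of_nonpos (by positivity) (by linarith) (by linarith)
      · exact (wt_integrableOn α (2 * R)).mono_set Set.sdiff_subset
    have hsc : (4 * R) ^ (-(2 * α)) * (3 * R ^ 2 * V) = ((4:ℝ) ^ (-(2 * α)) * 3 * V) * sc α n := by
      unfold sc
      rw [Real.mul_rpow (by norm_num) (by linarith)]
      ring
    rw [hsc] at hann
    rw [hR2]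
    have hc : 0 < (4:ℝ) ^ (-(2 * α)) * 3 * V := by have := V_pos; positivity
    have := mul_le_mul_of_nonneg_left (sc_succ α hα n)
      (by positivity : 0 ≤ ((n + 1 : ℕ) : ℝ) * ((4:ℝ) ^ (-(2 * α)) * 3 * V))
    refine this.trans ?_
    push_cast
    nlinarith

theorem weighted_lower_bound_fails_of_one_le
    (α : ℝ) (hα : 1 ≤ α) :
    ¬ ∃ c : ℝ, 0 < c ∧
      ∀ (φ : EuclideanSpace ℝ (Fin 2) → ℂ) (K : NNReal),
        LipschitzWith K φ → HasCompactSupport φ →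
        ∫ x : EuclideanSpace ℝ (Fin 2),
            (1 + ‖x‖) ^ (-(2 * α)) *
              ‖fderiv ℝ φ x (EuclideanSpace.single 0 1) -
                Complex.I * fderiv ℝ φ x (EuclideanSpace.single 1 1)‖ ^ 2 ≥
          c * ∫ x : EuclideanSpace ℝ (Fin 2),
            (1 + ‖x‖) ^ (-(2 * α)) *
              (‖fderiv ℝ φ x (EuclideanSpace.single 0 1)‖ ^ 2 +
                ‖fderiv ℝ φ x (EuclideanSpace.single 1 1)‖ ^ 2) := by
  rintro ⟨c, hc, H⟩
  obtain ⟨ψ, hψ, hsupp, hin, hout⟩ := exists_psi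
  have hcontD : Continuous (fderiv ℝ ψ) := hψ.continuous_fderiv (by norm_num)
  -- a bound on the operator applied to ψ
  obtain ⟨M, hM⟩ : ∃ M : ℝ, ∀ x, ‖fderiv ℝ ψ x (EuclideanSpace.single 0 1) -
      Complex.I * fderiv ℝ ψ x (EuclideanSpace.single 1 1)‖ ^ 2 ≤ M := by
    have hcs := hsupp.fderiv (𝕜 := ℝ)
    obtain ⟨C, hC⟩ := hcs.exists_bound_of_continuous hcontD
    refine ⟨(C + C) ^ 2, fun x => ?_⟩
    have h1 : ∀ i : Fin 2, ‖fderiv ℝ ψ x (EuclideanSpace.single i 1)‖ ≤ C := fun i =>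
      ((fderiv ℝ ψ x).le_opNorm _).trans (by simpa using hC x)
    refine pow_le_pow_left₀ (norm_nonneg _) ((norm_sub_le _ _).trans ?_) 2
    rw [norm_mul, Complex.norm_I, one_mul]
    exact add_le_add (h1 0) (h1 1)
  have hM0 : 0 ≤ M := (by positivity : (0:ℝ) ≤ _).trans (hM 0)
  have key : ∀ n : ℕ, c * (2 * (n * ((4:ℝ) ^ (-(2 * α)) * 3 * V))) ≤ M * 4 * V := by
    intro n
    have h0 : (1:ℝ) ≤ 2 ^ n := one_le_pow₀ (by norm_num)
    have hlow := lower α hα n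
    have hscp := sc_pos α n
    have hsc : sc α n = ((2:ℝ) ^ n) ^ (-(2 * α)) * ((2:ℝ) ^ n) ^ 2 := rfl
    set R : ℝ := 2 ^ n with hR
    have hRpos : 0 < R := by linarith
    let φ : PlaneE → ℂ := fun x => ψ (R⁻¹ • x)
    have hφ : ContDiff ℝ 1 φ := hψ.comp (contDiff_const_smul _)
    have hφs : HasCompactSupport φ := hsupp.comp_smul (inv_ne_zero hRpos.ne')
    have hD : ∀ x v, fderiv ℝ φ x v = (R⁻¹ : ℝ) • fderiv ℝ ψ (R⁻¹ • x) v := by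
      intro x v
      have : fderiv ℝ φ x = R⁻¹ • fderiv ℝ ψ (R⁻¹ • x) := fderiv_comp_smul _
      rw [this]; rfl
    obtain ⟨K, hK⟩ := hφ.lipschitzWith_of_hasCompactSupport hφs (by norm_num)
    have hmain := H φ K hK hφs
    have hcontφ : Continuous (fderiv ℝ φ) := hφ.continuous_fderiv (by norm_num)
    have hout' : ∀ x : PlaneE, 2 * R < ‖x‖ → ∀ v, fderiv ℝ φ x v = 0 := by
      intro x hx v
      rw [hD, hout]
      · simp
      · rw [norm_smul, Real.norm_of_nonneg (by positivity), inv_mul_eq_div, lt_div_iff₀ hRpos]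
        exact hx
    have hin' : ∀ x : PlaneE, ‖x‖ < R → ∀ v, fderiv ℝ φ x v = (R⁻¹ : ℝ) • conjCLM v := by
      intro x hx v
      rw [hD, hin]
      rw [norm_smul, Real.norm_of_nonneg (by positivity), inv_mul_eq_div, div_lt_one hRpos]
      exact hx
    -- upper bound
    have hup : ∫ x : PlaneE, (1 + ‖x‖) ^ (-(2 * α)) *
              ‖fderiv ℝ φ x (EuclideanSpace.single 0 1) -
                Complex.I * fderiv ℝ φ x (EuclideanSpace.single 1 1)‖ ^ 2 ≤
          R⁻¹ ^ 2 * (M * 4 * V * sc α n) := by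
      have hle : ∀ x : PlaneE, (1 + ‖x‖) ^ (-(2 * α)) *
              ‖fderiv ℝ φ x (EuclideanSpace.single 0 1) -
                Complex.I * fderiv ℝ φ x (EuclideanSpace.single 1 1)‖ ^ 2 ≤
          (Metric.closedBall (0 : PlaneE) (2 * R)).indicator
            (fun _ => R ^ (-(2 * α)) * (R⁻¹ ^ 2 * M)) x := by
        intro x
        have hpos : 0 ≤ R ^ (-(2 * α)) * (R⁻¹ ^ 2 * M) := by positivity
        rcases lt_or_ge (2 * R) ‖x‖ with hx | hx
        · rw [hout' x hx, hout' x hx]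
          simp only [mul_zero, sub_zero, norm_zero, ne_eq, OfNat.ofNat_ne_zero,
            not_false_eq_true, zero_pow]
          exact Set.indicator_nonneg (fun _ _ => hpos) _
        · rw [Set.indicator_of_mem (by simpa using hx)]
          rcases lt_or_ge ‖x‖ R with hx2 | hx2
          · rw [hin' x hx2, hin' x hx2, conjCLM_zero, conjCLM_one]
            refine le_trans (le_of_eq ?_) hpos
            have : (R⁻¹ : ℝ) • (1:ℂ) - Complex.I * (R⁻¹ : ℝ) • (-Complex.I) = 0 := by
              simp only [Complex.real_smul]
              linear_combination (((R⁻¹ : ℝ)) : ℂ) * Complex.I_mul_I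
            rw [this]; simp
          · refine mul_le_mul ?_ ?_ (by positivity) (by positivity)
            · exact Real.rpow_le_rpow_of_nonpos hRpos (by linarith) (by linarith)
            · rw [hD, hD, mul_smul_comm, ← smul_sub, norm_smul, mul_pow,
                Real.norm_of_nonneg (by positivity)]
              exact mul_le_mul_of_nonneg_left (hM _) (by positivity)
      have hint : Integrable ((Metric.closedBall (0 : PlaneE) (2 * R)).indicator
            (fun _ => R ^ (-(2 * α)) * (R⁻¹ ^ 2 * M))) := by
        rw [integrable_indicator_iff Metric.isClosed_closedBall.measurableSet]
        exact integrableOn_const (measure_closedBall_lt_top.ne)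
      refine (integral_mono_of_nonneg (Filter.Eventually.of_forall fun x => by positivity) hint
        (Filter.Eventually.of_forall hle)).trans (le_of_eq ?_)
      rw [integral_indicator_const _ Metric.isClosed_closedBall.measurableSet]
      have : volume.real (Metric.closedBall (0 : PlaneE) (2 * R)) = (2 * R) ^ 2 * V := by
        rw [← vol_ball _ (by linarith)]
        exact congrArg ENNReal.toReal (Measure.addHaar_closedBall_eq_addHaar_ball _ _ _)
      rw [this, hsc, smul_eq_mul]
      ring
    -- lower bound
    have hlo : R⁻¹ ^ 2 * (2 * ∫ x in Metric.ball (0 : PlaneE) R, wt α x) ≤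
        ∫ x : PlaneE, (1 + ‖x‖) ^ (-(2 * α)) *
              (‖fderiv ℝ φ x (EuclideanSpace.single 0 1)‖ ^ 2 +
                ‖fderiv ℝ φ x (EuclideanSpace.single 1 1)‖ ^ 2) := by
      have hw : Continuous fun x : PlaneE => (1 + ‖x‖) ^ (-(2 * α)) := wt_cont α
      have hc1 : Continuous fun x : PlaneE => (1 + ‖x‖) ^ (-(2 * α)) *
              (‖fderiv ℝ φ x (EuclideanSpace.single 0 1)‖ ^ 2 +
                ‖fderiv ℝ φ x (EuclideanSpace.single 1 1)‖ ^ 2) := by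
        fun_prop
      have hint : Integrable fun x : PlaneE => (1 + ‖x‖) ^ (-(2 * α)) *
              (‖fderiv ℝ φ x (EuclideanSpace.single 0 1)‖ ^ 2 +
                ‖fderiv ℝ φ x (EuclideanSpace.single 1 1)‖ ^ 2) := by
        refine hc1.integrable_of_hasCompactSupport ?_
        refine HasCompactSupport.intro (isCompact_closedBall (0 : PlaneE) (2 * R)) ?_
        intro x hx
        have hx' : 2 * R < ‖x‖ := by simpa using hx
        rw [hout' x hx', hout' x hx']
        simp
      refine le_trans (le_of_eq ?_) (setIntegral_le_integral (s := Metric.ball (0 : PlaneE) R) hint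
        (Filter.Eventually.of_forall fun x => by positivity))
      rw [← integral_const_mul, ← integral_const_mul]
      refine setIntegral_congr_fun Metric.isOpen_ball.measurableSet ?_
      intro x hx
      have hx' : ‖x‖ < R := by simpa using hx
      simp only [hin' x hx', conjCLM_zero, conjCLM_one, wt, norm_smul, norm_neg, Complex.norm_I,
        norm_one, Real.norm_of_nonneg (inv_nonneg.2 hRpos.le)]
      ring
    have h1 : c * (R⁻¹ ^ 2 * (2 * (n * ((4:ℝ) ^ (-(2 * α)) * 3 * V) * sc α n))) ≤
        R⁻¹ ^ 2 * (M * 4 * V * sc α n) := by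
      refine le_trans ?_ (hmain.le.trans hup)
      refine le_trans ?_ (mul_le_mul_of_nonneg_left hlo hc.le)
      gcongr
    have hp : 0 < R⁻¹ ^ 2 * sc α n := by positivity
    refine le_of_mul_le_mul_right ?_ hp
    linarith
  have hd : 0 < c * (2 * ((4:ℝ) ^ (-(2 * α)) * 3 * V)) := by have := V_pos; positivity
  obtain ⟨n, hn⟩ := exists_nat_gt (M * 4 * V / (c * (2 * ((4:ℝ) ^ (-(2 * α)) * 3 * V))))
  rw [div_lt_iff₀ hd] at hn
  have := key n
  linarith
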